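/- There does not exist a homotopy H : ℝP² × [0,1] → ℝP³ such that H(x,0) = x for all x in a standardly embedded ℝP² ⊂ ℝP³ and H(ℝP², 1) is contained in an embedded copy of Dyck's surface ℝP² # T in ℝP³. -/

import Mathlib

open Set Metric Topology unitInterval

noncomputable section
open Classical

variable {B : Type*} [NormedAddCommGroup B] [NormedSpace ℝ B]

/-- There exists a continuous, odd, nonvanishing map `A → ℝ^m \ {0}`. -/
def HasOddMap (A : Set B) (m : ℕ) : Prop :=
  ∃ h : A → (Fin m → ℝ), Continuous h ∧ (∀ x, h x ≠ 0) ∧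
    ∀ (x : A) (hx : -(x : B) ∈ A), h ⟨-(x : B), hx⟩ = -h x

/-- Krasnoselskii genus. -/
def genus (A : Set B) : ℕ∞ :=
  if A = ∅ then 0 else sInf {m : ℕ∞ | ∃ k : ℕ, m = k ∧ HasOddMap A k}

/-- A set is contractible within the ambient space `Φ`. -/
def ContractibleIn {Φ : Type*} [TopologicalSpace Φ] (C : Set Φ) : Prop :=
  ∃ x₀ : Φ, ∃ H : C(↥C × ↥I, Φ),
    (∀ x : C, H (x, 0) = (x : Φ)) ∧ (∀ x : C, H (x, 1) = x₀)

/-- Lusternik–Schnirelmann subspace category (with closed covers). -/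
def catLS {Φ : Type*} [TopologicalSpace Φ] (A : Set Φ) : ℕ∞ :=
  sInf {m : ℕ∞ | ∃ k : ℕ, m = k ∧ ∃ C : Fin k → Set Φ,
    (∀ i, IsClosed (C i)) ∧ (∀ i, ContractibleIn (C i)) ∧ A ⊆ ⋃ i, C i}

/-- `X` can be brought to `Y` via a homotopy in `Φ` starting from the inclusion. -/
def BringsTo {Φ : Type*} [TopologicalSpace Φ] (X Y : Set Φ) : Prop :=
  ∃ H : C(↥X × ↥I, Φ),
    (∀ x : X, H (x, 0) = (x : Φ)) ∧ (∀ x : X, H (x, 1) ∈ Y)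

/-- `a` lies in the homotopy significant spectrum of `f`. -/
def HomotopySignificant {Φ : Type*} [TopologicalSpace Φ] (f : Φ → ℝ) (a : ℝ) : Prop :=
  ¬ BringsTo {x | f x ≤ a} {x | f x < a}

/-- `e` is a weak homotopy significant eigenvalue of `f`. -/
def WeakHomotopySignificant {Φ : Type*} [TopologicalSpace Φ] (f : Φ → ℝ) (e : ℝ) : Prop :=
  ∀ t₁ > e, ∀ t₂ < e, ¬ BringsTo {x | f x ≤ t₁} {x | f x ≤ t₂}

/-- The k-th Krasnoselskii eigenvalue of (the restriction to the unit sphere of) `f`. -/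
def kr (f : B → ℝ) (k : ℕ) : EReal :=
  ⨅ A ∈ {A : Set B | A ⊆ sphere (0 : B) 1 ∧ IsClosed A ∧ A = -A ∧ (k : ℕ∞) ≤ genus A},
    ⨆ x ∈ A, (f x : EReal)

/-- The k-th category (min-max) eigenvalue of `f`. -/
def hs {Φ : Type*} [TopologicalSpace Φ] (f : Φ → ℝ) (k : ℕ) : EReal :=
  ⨅ A ∈ {A : Set Φ | IsClosed A ∧ (k : ℕ∞) ≤ catLS A}, ⨆ x ∈ A, (f x : EReal)

/-- The antipodal setoid on the unit sphere of `B`. -/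
def projSetoid (B : Type*) [NormedAddCommGroup B] [NormedSpace ℝ B] :
    Setoid ↥(sphere (0 : B) 1) where
  r x y := (x : B) = y ∨ (x : B) = -(y : B)
  iseqv := by
    constructor
    · intro x; exact Or.inl rfl
    · rintro x y (h | h)
      · exact Or.inl h.symm
      · exact Or.inr (by rw [h, neg_neg])
    · rintro x y z (h | h) (h' | h')
      · exact Or.inl (h.trans h')
      · exact Or.inr (by rw [h, h'])
      · exact Or.inr (by rw [h, h'])
      · exact Or.inl (by rw [h, h', neg_neg])

/-- The projective space of `B`, as the quotient of the unit sphere by the antipodal map. -/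
def Proj (B : Type*) [NormedAddCommGroup B] [NormedSpace ℝ B] := Quotient (projSetoid B)

instance : TopologicalSpace (Proj B) := instTopologicalSpaceQuotient


/-- The gluing relation for the hexagon word `aabbcc`: a boundary point at angle `θ`
in one of the three even arcs is identified with the point at angle `θ + π/3`. -/
def dyckRel (z w : ℂ) : Prop :=
  ∃ k : Fin 3, ∃ θ : ℝ,
    θ ∈ Set.Icc ((2 * (k : ℝ)) * Real.pi / 3) ((2 * (k : ℝ)) * Real.pi / 3 + Real.pi / 3) ∧
    z = Complex.exp (θ * Complex.I) ∧ w = Complex.exp ((θ + Real.pi / 3) * Complex.I)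

/-- Dyck's surface `ℝP² # T` (the non-orientable surface of non-orientable genus 3),
realized as the hexagon (here, the closed unit disc) with boundary word `aabbcc`. -/
def DyckSurface :=
  Quot (fun z w : ↥(Metric.closedBall (0 : ℂ) 1) => dyckRel (z : ℂ) (w : ℂ))

instance : TopologicalSpace DyckSurface := instTopologicalSpaceQuot

/-! ### Elementary lemmas -/

lemma zero_of_self_neg {E : Type*} [NormedAddCommGroup E] [NormedSpace ℝ E] {x : E}
    (h : x = -x) : x = 0 := by
  have h2 : (2 : ℝ) • x = 0 := by
    rw [two_smul]
    nth_rewrite 1 [h]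
    simp
  exact (smul_eq_zero.1 h2).resolve_left two_ne_zero

/-- Two functions that agree up to sign on a preconnected space agree up to a global sign. -/
lemma global_sign {X E : Type*} [TopologicalSpace X] [NormedAddCommGroup E] [NormedSpace ℝ E]
    {S : Set X} (hS : IsPreconnected S) {f g : X → E} (hf : ContinuousOn f S)
    (hg : ContinuousOn g S) (hne : ∀ x ∈ S, g x ≠ 0)
    (h : ∀ x ∈ S, f x = g x ∨ f x = -g x) :
    (∀ x ∈ S, f x = g x) ∨ (∀ x ∈ S, f x = -g x) := by
  have hS' : PreconnectedSpace S := isPreconnected_iff_preconnectedSpace.1 hS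
  have hf' : Continuous (fun x : S => f x) := continuousOn_iff_continuous_domRestrict.1 hf
  have hg' : Continuous (fun x : S => g x) := continuousOn_iff_continuous_domRestrict.1 hg
  have c1 : IsClosed {x : S | f x = g x} := isClosed_eq hf' hg'
  have c2 : IsClosed {x : S | f x = -g x} := isClosed_eq hf' hg'.neg
  have hc : {x : S | f x = g x}ᶜ = {x : S | f x = -g x} := by
    ext x
    simp only [mem_compl_iff, mem_ofPred_eq]
    constructor
    · intro hx
      exact (h x x.2).resolve_left hx
    · intro hx hx'
      have : g x = -g x := hx'.symm.trans hx
      exact hne x x.2 (zero_of_self_neg this)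
  have hcl : IsClopen {x : S | f x = g x} := by
    refine ⟨c1, ?_⟩
    rw [← isClosed_compl_iff, hc]
    exact c2
  rcases isClopen_iff.1 hcl with h0 | h1
  · right
    intro x hx
    refine (h x hx).resolve_left (fun he => ?_)
    have : (⟨x, hx⟩ : S) ∈ {x : S | f x = g x} := he
    rw [h0] at this
    exact this
  · left
    intro x hx
    have : (⟨x, hx⟩ : S) ∈ {x : S | f x = g x} := by rw [h1]; trivial
    exact this

/-- Angles whose doubles agree differ by a sign. -/
lemma half_angle {a b : ℝ} (hc : Real.cos (2 * a) = Real.cos (2 * b))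
    (hs : Real.sin (2 * a) = Real.sin (2 * b)) :
    ∃ ε : ℝ, (ε = 1 ∨ ε = -1) ∧ Real.cos a = ε * Real.cos b ∧ Real.sin a = ε * Real.sin b := by
  have h1 : Real.cos (2 * (a - b)) = 1 := by
    rw [mul_sub, Real.cos_sub, hc, hs]
    nlinarith [Real.sin_sq_add_cos_sq (2 * b)]
  have h2 : Real.cos (a - b) ^ 2 = 1 := by
    rw [Real.cos_two_mul] at h1
    linarith
  have h3 : Real.sin (a - b) = 0 := by
    have := Real.sin_sq_add_cos_sq (a - b)
    have : Real.sin (a - b) ^ 2 = 0 := by linarith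
    exact pow_eq_zero_iff two_ne_zero |>.1 this
  refine ⟨Real.cos (a - b), by simpa using h2, ?_, ?_⟩
  · have : a = (a - b) + b := by ring
    conv_lhs => rw [this, Real.cos_add, h3]
    ring
  · have : a = (a - b) + b := by ring
    conv_lhs => rw [this, Real.sin_add, h3]
    ring

/-- Lifting of circle valued maps on the plane. -/
lemma angle_lift {c s : ℂ → ℝ} (hc : Continuous c) (hs : Continuous s)
    (h : ∀ z, c z ^ 2 + s z ^ 2 = 1) :
    ∃ L : ℂ → ℝ, Continuous L ∧ (∀ z, Real.cos (2 * (Real.pi * L z)) = c z) ∧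
      ∀ z, Real.sin (2 * (Real.pi * L z)) = s z := by
  have hn : ∀ z, (⟨c z, s z⟩ : ℂ) ∈ Submonoid.unitSphere ℂ := by
    intro z
    have : ‖(⟨c z, s z⟩ : ℂ)‖ = 1 := by
      rw [Complex.norm_def, Complex.normSq_mk]
      have := h z
      rw [show c z * c z + s z * s z = 1 by nlinarith, Real.sqrt_one]
    exact mem_sphere_zero_iff_norm.2 this
  have hcont : Continuous (fun z => (⟨c z, s z⟩ : ℂ)) := by
    have : (fun z => (⟨c z, s z⟩ : ℂ)) = fun z => (c z : ℂ) + s z * Complex.I := by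
      ext z
      exact Complex.mk_eq_add_mul_I _ _
    rw [this]
    fun_prop
  let f : C(ℂ, Circle) := ⟨fun z => ⟨⟨c z, s z⟩, hn z⟩, hcont.subtype_mk hn⟩
  obtain ⟨t, ht⟩ : ∃ t : ℝ, Circle.exp t = f 0 := ⟨_, Circle.exp_arg _⟩
  obtain ⟨F, ⟨-, hF⟩, -⟩ := Circle.isCoveringMap_exp.existsUnique_continuousMap_lifts f 0 t ht
  have key : ∀ z, Complex.exp ((F z : ℂ) * Complex.I) = ⟨c z, s z⟩ := by
    intro z
    have := congrArg (fun w : Circle => (w : ℂ)) (congrFun hF z)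
    exact this
  have e : ∀ z, 2 * (Real.pi * (F z / (2 * Real.pi))) = F z := by
    intro z
    field_simp
  refine ⟨fun z => F z / (2 * Real.pi), by fun_prop, fun z => ?_, fun z => ?_⟩
  · have := congrArg Complex.re (key z)
    rw [Complex.exp_ofReal_mul_I_re] at this
    simp only [e, this]
  · have := congrArg Complex.im (key z)
    rw [Complex.exp_ofReal_mul_I_im] at this
    simp only [e, this]

/-- A real function on the plane which is even mod `1` on the unit circle is even there. -/
lemma even_lift {L : ℂ → ℝ} (hL : Continuous L)
    (hc : ∀ z : ℂ, ‖z‖ = 1 → Real.cos (2 * (Real.pi * L (-z))) = Real.cos (2 * (Real.pi * L z)))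
    (hs : ∀ z : ℂ, ‖z‖ = 1 → Real.sin (2 * (Real.pi * L (-z))) = Real.sin (2 * (Real.pi * L z))) :
    ∀ z : ℂ, ‖z‖ = 1 → L (-z) = L z := by
  let c : ℝ → ℂ := fun θ => Complex.exp (θ * Complex.I)
  have hcc : Continuous c := by fun_prop
  have hcn : ∀ θ, ‖c θ‖ = 1 := fun θ => Complex.norm_exp_ofReal_mul_I θ
  let g : ℝ → ℝ := fun θ => L (-c θ) - L (c θ)
  have hg : Continuous g := by fun_prop
  have hint : ∀ θ, ∃ n : ℤ, (n : ℝ) = g θ := by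
    intro θ
    have h1 : Real.cos (2 * (Real.pi * g θ)) = 1 := by
      have : 2 * (Real.pi * g θ) = 2 * (Real.pi * L (-c θ)) - 2 * (Real.pi * L (c θ)) := by
        simp only [g]; ring
      rw [this, Real.cos_sub, hc _ (hcn θ), hs _ (hcn θ)]
      nlinarith [Real.sin_sq_add_cos_sq (2 * (Real.pi * L (c θ)))]
    obtain ⟨n, hn⟩ := (Real.cos_eq_one_iff _).1 h1
    refine ⟨n, ?_⟩
    have hp := Real.pi_pos
    have : (2 * Real.pi) * ((n : ℝ) - g θ) = 0 := by linarith
    rcases mul_eq_zero.1 this with h | h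
    · linarith
    · linarith
  choose n hn using hint
  have hnc : Continuous n := by
    rw [Int.isClosedEmbedding_coe_real.isInducing.continuous_iff]
    exact hg.congr (fun θ => (hn θ).symm)
  have hconst : ∀ x y, n x = n y := fun x y => PreconnectedSpace.constant inferInstance hnc
  intro z hz
  have harg : c (Complex.arg z) = z := by
    have := Complex.norm_mul_exp_arg_mul_I z
    rw [hz] at this
    simpa [c] using this
  have harg2 : c (Complex.arg z + Real.pi) = -z := by
    have : c (Complex.arg z + Real.pi) = c (Complex.arg z) * Complex.exp (Real.pi * Complex.I) := by
      simp only [c]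
      rw [← Complex.exp_add]
      push_cast
      ring_nf
    rw [this, harg, Complex.exp_pi_mul_I]
    ring
  have h1 := hn (Complex.arg z)
  have h2 := hn (Complex.arg z + Real.pi)
  rw [hconst (Complex.arg z + Real.pi) (Complex.arg z)] at h2
  simp only [g, harg, harg2, neg_neg] at h1 h2
  linarith

/-! ### The disc and its boundary -/

/-- The closed unit disc. -/
abbrev Dsc := ↥(Metric.closedBall (0 : ℂ) 1)

/-- The boundary point at angle `θ`. -/
def bp (θ : ℝ) : Dsc :=
  ⟨Complex.exp (θ * Complex.I), by simp [Complex.norm_exp_ofReal_mul_I]⟩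

lemma continuous_bp : Continuous bp := by
  unfold bp
  fun_prop

/-- The quotient map from the disc to Dyck's surface. -/
def toDyck (z : Dsc) : DyckSurface := Quot.mk _ z

lemma continuous_toDyck : Continuous toDyck := continuous_quot_mk

/-- The parameter interval of the `k`-th arc. -/
def arc (k : Fin 3) : Set ℝ :=
  Set.Icc ((2 * (k : ℝ)) * Real.pi / 3) ((2 * (k : ℝ)) * Real.pi / 3 + Real.pi / 3)

/-- Functions on the disc compatible with the gluing descend to Dyck's surface. -/
lemma descend {Y : Type*} [TopologicalSpace Y] {f : Dsc → Y} (hf : Continuous f)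
    (h : ∀ k, ∀ θ ∈ arc k, f (bp (θ + Real.pi / 3)) = f (bp θ)) :
    ∃ g : DyckSurface → Y, Continuous g ∧ ∀ z, g (toDyck z) = f z := by
  refine ⟨Quot.lift f ?_, continuous_quot_lift _ hf, fun z => rfl⟩
  rintro a b ⟨k, θ, hθ, ha, hb⟩
  have ha' : a = bp θ := Subtype.ext ha
  have hb' : b = bp (θ + Real.pi / 3) := Subtype.ext (by rw [hb]; simp [bp])
  rw [ha', hb', h k θ hθ]

lemma toDyck_glue {k : Fin 3} {θ : ℝ} (hθ : θ ∈ arc k) :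
    toDyck (bp (θ + Real.pi / 3)) = toDyck (bp θ) := by
  symm
  exact Quot.sound ⟨k, θ, hθ, rfl, by simp [bp]⟩

lemma toDyck_surj : Function.Surjective toDyck := Quot.mk_surjective

/-- Extending a function from the boundary to the disc. -/
lemma bdry_ext {b : ℝ → ℝ} (hb : Continuous b) (h : b 0 = b (2 * Real.pi)) :
    ∃ f : Dsc → ℝ, Continuous f ∧ ∀ θ ∈ Set.Icc 0 (2 * Real.pi), f (bp θ) = b θ := by
  have : Fact (0 < 2 * Real.pi) := ⟨by positivity⟩
  let g : C(AddCircle (2 * Real.pi), ℝ) :=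
    ⟨AddCircle.liftIco (2 * Real.pi) 0 b, AddCircle.liftIco_zero_continuous h hb.continuousOn⟩
  let g' : C(Circle, ℝ) := g.comp ⟨_, AddCircle.homeomorphCircle'.symm.continuous⟩
  let e : Circle → Dsc := fun z => ⟨z, by rw [mem_closedBall_zero_iff, Circle.norm_coe]⟩
  have he : IsClosedEmbedding e := by
    apply Continuous.isClosedEmbedding
    · fun_prop
    · intro x y hxy
      exact Circle.ext (congrArg (fun w : Dsc => (w : ℂ)) hxy)
  obtain ⟨f, hf⟩ := ContinuousMap.exists_extension' he g'
  refine ⟨f, f.continuous, ?_⟩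
  have key : ∀ θ ∈ Set.Ico 0 (2 * Real.pi), f (bp θ) = b θ := by
    intro θ hθ
    have h1 : bp θ = e (Circle.exp θ) := rfl
    have h2 := congrFun hf (Circle.exp θ)
    rw [h1]
    refine h2.trans ?_
    change g (AddCircle.homeomorphCircle'.symm (Circle.exp θ)) = b θ
    rw [← AddCircle.homeomorphCircle'_apply_mk, Homeomorph.symm_apply_apply]
    exact AddCircle.liftIco_zero_coe_apply hθ
  intro θ hθ
  rcases hθ.2.lt_or_eq with hlt | heq
  · exact key θ ⟨hθ.1, hlt⟩
  · have h0 : bp θ = bp 0 := by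
      apply Subtype.ext
      simp [bp, heq]
    rw [h0, key 0 ⟨le_rfl, by positivity⟩, heq, h]

/-! ### Classes that become trivial on the projective plane -/

/-- The quaternion with given coordinates. -/
def qv (a b c d : ℝ) : Quaternion ℝ := ⟨a, b, c, d⟩

lemma continuous_qv {X : Type*} [TopologicalSpace X] {a b c d : X → ℝ} (ha : Continuous a)
    (hb : Continuous b) (hc : Continuous c) (hd : Continuous d) :
    Continuous (fun x => qv (a x) (b x) (c x) (d x)) := by
  have h1 : Continuous (fun x => (!₂[a x, b x, c x, d x] : EuclideanSpace ℝ (Fin 4))) := by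
    refine (PiLp.continuous_toLp 2 _).comp (continuous_pi fun i => ?_)
    fin_cases i <;> simpa
  exact Quaternion.linearIsometryEquivTuple.symm.continuous.comp h1

lemma smul_qv (r a b c d : ℝ) : r • qv a b c d = qv (r * a) (r * b) (r * c) (r * d) := by
  rfl

lemma neg_qv (a b c d : ℝ) : -qv a b c d = qv (-a) (-b) (-c) (-d) := by
  rfl

lemma qv_ne_zero {a b c d : ℝ} (h : a ^ 2 + b ^ 2 + c ^ 2 + d ^ 2 = 1) : qv a b c d ≠ 0 := by
  intro h0
  have h1 : a = 0 := congrArg QuaternionAlgebra.re h0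
  have h2 : b = 0 := congrArg QuaternionAlgebra.imI h0
  have h3 : c = 0 := congrArg QuaternionAlgebra.imJ h0
  have h4 : d = 0 := congrArg QuaternionAlgebra.imK h0
  rw [h1, h2, h3, h4] at h
  norm_num at h

/-- The sign system `s` on the edges of the hexagon is realized by a nowhere zero twisted
quaternion valued function, which pulls back along `F` to a function on the plane that is
even on the unit circle. -/
def Triv (F : ℂ → DyckSurface) (s : Fin 3 → ℝ) : Prop :=
  ∃ (v : Dsc → Quaternion ℝ) (V : ℂ → Quaternion ℝ), Continuous v ∧ Continuous V ∧
    (∀ z, v z ≠ 0) ∧ (∀ x, V x ≠ 0) ∧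
    (∀ k, ∀ θ ∈ arc k, v (bp (θ + Real.pi / 3)) = s k • v (bp θ)) ∧
    (∀ x : ℂ, ‖x‖ = 1 → V (-x) = V x) ∧
    (∀ z x, toDyck z = F x → V x = v z ∨ V x = -v z)

lemma Triv.mul {F : ℂ → DyckSurface} {s t : Fin 3 → ℝ} (hs : Triv F s) (ht : Triv F t) :
    Triv F (fun k => s k * t k) := by
  obtain ⟨v, V, cv, cV, nv, nV, gv, eV, hV⟩ := hs
  obtain ⟨w, W, cw, cW, nw, nW, gw, eW, hW⟩ := ht
  refine ⟨fun z => v z * w z, fun x => V x * W x, cv.mul cw, cV.mul cW,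
    fun z => mul_ne_zero (nv z) (nw z), fun x => mul_ne_zero (nV x) (nW x), ?_, ?_, ?_⟩
  · intro k θ hθ
    simp only [gv k θ hθ, gw k θ hθ, smul_mul_smul_comm]
  · intro x hx
    simp only [eV x hx, eW x hx]
  · intro z x h
    rcases hV z x h with h1 | h1 <;> rcases hW z x h with h2 | h2 <;> simp [h1, h2]

/-- The Klein bottle argument. -/
lemma klein {F : ℂ → DyckSurface} (hF : Continuous F) (hev : ∀ x : ℂ, ‖x‖ = 1 → F (-x) = F x)
    {X Y : Dsc → ℝ} (hX : Continuous X) (hY : Continuous Y) {s t : Fin 3 → ℝ}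
    (H : ∀ k, ∀ θ ∈ arc k,
      (s k = -1 ∧ t k = 1 ∧ X (bp (θ + Real.pi / 3)) = X (bp θ) + 1 ∧
        Y (bp (θ + Real.pi / 3)) = -Y (bp θ)) ∨
      (s k = -1 ∧ t k = -1 ∧ X (bp (θ + Real.pi / 3)) = X (bp θ) - 1 ∧
        Y (bp (θ + Real.pi / 3)) = 1 - Y (bp θ)) ∨
      (s k = 1 ∧ t k = 1 ∧ X (bp (θ + Real.pi / 3)) = X (bp θ) ∧
        Y (bp (θ + Real.pi / 3)) = Y (bp θ))) :
    Triv F s ∧ Triv F t := by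
  have a1 : ∀ x : ℝ, 2 * (Real.pi * (x + 1)) = 2 * (Real.pi * x) + 2 * Real.pi := by
    intro x; ring
  have a2 : ∀ x : ℝ, 2 * (Real.pi * (x - 1)) = 2 * (Real.pi * x) - 2 * Real.pi := by
    intro x; ring
  have a3 : ∀ x : ℝ, 2 * (Real.pi * (-x)) = - (2 * (Real.pi * x)) := by
    intro x; ring
  have a4 : ∀ x : ℝ, 2 * (Real.pi * (1 - x)) = 2 * Real.pi - (2 * (Real.pi * x)) := by
    intro x; ring
  have b1 : ∀ x : ℝ, Real.pi * (x + 1) = Real.pi * x + Real.pi := by intro x; ring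
  have b2 : ∀ x : ℝ, Real.pi * (x - 1) = Real.pi * x - Real.pi := by intro x; ring
  have b3 : ∀ x : ℝ, Real.pi * (-x) = - (Real.pi * x) := by intro x; ring
  have b4 : ∀ x : ℝ, Real.pi * (1 - x) = Real.pi - (Real.pi * x) := by intro x; ring
  obtain ⟨c1, hc1, hc1'⟩ := descend (f := fun z => Real.cos (2 * (Real.pi * X z))) (by fun_prop) (by
    intro k θ hθ
    rcases H k θ hθ with ⟨-, -, h, -⟩ | ⟨-, -, h, -⟩ | ⟨-, -, h, -⟩ <;> simp [h, a1, a2])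
  obtain ⟨s1, hs1, hs1'⟩ := descend (f := fun z => Real.sin (2 * (Real.pi * X z))) (by fun_prop) (by
    intro k θ hθ
    rcases H k θ hθ with ⟨-, -, h, -⟩ | ⟨-, -, h, -⟩ | ⟨-, -, h, -⟩ <;> simp [h, a1, a2])
  obtain ⟨L, hL, hLc, hLs⟩ := angle_lift (hc1.comp hF) (hs1.comp hF) (by
    intro x
    obtain ⟨z, hz⟩ := toDyck_surj (F x)
    simp only [Function.comp, ← hz, hc1', hs1']
    exact Real.cos_sq_add_sin_sq _)
  have hLe : ∀ x : ℂ, ‖x‖ = 1 → L (-x) = L x := by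
    apply even_lift hL
    · intro x hx
      rw [hLc, hLc, Function.comp, Function.comp, hev x hx]
    · intro x hx
      rw [hLs, hLs, Function.comp, Function.comp, hev x hx]
  have hLX : ∀ z x, toDyck z = F x → ∃ ε : ℝ, (ε = 1 ∨ ε = -1) ∧
      Real.cos (Real.pi * L x) = ε * Real.cos (Real.pi * X z) ∧
      Real.sin (Real.pi * L x) = ε * Real.sin (Real.pi * X z) := by
    intro z x h
    apply half_angle
    · rw [hLc, Function.comp, ← h, hc1']
    · rw [hLs, Function.comp, ← h, hs1']
  obtain ⟨c2, hc2, hc2'⟩ := descend (f := fun z => Real.cos (2 * (Real.pi * Y z))) (by fun_prop) (by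
    intro k θ hθ
    rcases H k θ hθ with ⟨-, -, -, h⟩ | ⟨-, -, -, h⟩ | ⟨-, -, -, h⟩ <;> simp [h, a4])
  obtain ⟨p, hp, hp'⟩ := descend
    (f := fun z => Real.sin (2 * (Real.pi * Y z)) * Real.cos (Real.pi * X z)) (by fun_prop) (by
    intro k θ hθ
    rcases H k θ hθ with ⟨-, -, h', h⟩ | ⟨-, -, h', h⟩ | ⟨-, -, h', h⟩ <;>
      simp [h, h', a4, b1, b2])
  obtain ⟨q, hq, hq'⟩ := descend
    (f := fun z => Real.sin (2 * (Real.pi * Y z)) * Real.sin (Real.pi * X z)) (by fun_prop) (by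
    intro k θ hθ
    rcases H k θ hθ with ⟨-, -, h', h⟩ | ⟨-, -, h', h⟩ | ⟨-, -, h', h⟩ <;>
      simp [h, h', a4, b1, b2])
  let S : ℂ → ℝ := fun x => Real.cos (Real.pi * L x) * p (F x) + Real.sin (Real.pi * L x) * q (F x)
  have hS : Continuous S := by fun_prop
  have hSe : ∀ x : ℂ, ‖x‖ = 1 → S (-x) = S x := by
    intro x hx
    simp only [S, hev x hx, hLe x hx]
  have hSX : ∀ z x, toDyck z = F x → ∀ ε : ℝ,
      Real.cos (Real.pi * L x) = ε * Real.cos (Real.pi * X z) →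
      Real.sin (Real.pi * L x) = ε * Real.sin (Real.pi * X z) →
      S x = ε * Real.sin (2 * (Real.pi * Y z)) := by
    intro z x h ε h1 h2
    simp only [S, ← h, hp', hq', h1, h2]
    linear_combination (ε * Real.sin (2 * (Real.pi * Y z))) *
      Real.cos_sq_add_sin_sq (Real.pi * X z)
  obtain ⟨M, hM, hMc, hMs⟩ := angle_lift (hc2.comp hF) hS (by
    intro x
    obtain ⟨z, hz⟩ := toDyck_surj (F x)
    obtain ⟨ε, hε, h1, h2⟩ := hLX z x hz
    rw [hSX z x hz ε h1 h2]
    simp only [Function.comp, ← hz, hc2']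
    have := Real.cos_sq_add_sin_sq (2 * (Real.pi * Y z))
    rcases hε with rfl | rfl <;> linarith)
  have hMe : ∀ x : ℂ, ‖x‖ = 1 → M (-x) = M x := by
    apply even_lift hM
    · intro x hx
      rw [hMc, hMc, Function.comp, Function.comp, hev x hx]
    · intro x hx
      rw [hMs, hMs, hSe x hx]
  constructor
  · refine ⟨fun z => qv (Real.cos (Real.pi * X z)) (Real.sin (Real.pi * X z)) 0 0,
      fun x => qv (Real.cos (Real.pi * L x)) (Real.sin (Real.pi * L x)) 0 0,
      continuous_qv (by fun_prop) (by fun_prop) (by fun_prop) (by fun_prop),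
      continuous_qv (by fun_prop) (by fun_prop) (by fun_prop) (by fun_prop),
      fun z => qv_ne_zero ?_, fun z => qv_ne_zero ?_, ?_, ?_, ?_⟩
    · simp
    · simp
    · intro k θ hθ
      rcases H k θ hθ with ⟨h, -, h', -⟩ | ⟨h, -, h', -⟩ | ⟨h, -, h', -⟩ <;>
        simp [h, h', smul_qv, b1, b2, -neg_smul]
    · intro x hx
      simp only [hLe x hx]
    · intro z x h
      obtain ⟨ε, hε, h1, h2⟩ := hLX z x h
      simp only [h1, h2]
      rcases hε with rfl | rfl
      · left; simp
      · right; rw [neg_qv]; simp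
  · refine ⟨fun z => qv (Real.cos (Real.pi * Y z)) (Real.sin (Real.pi * Y z) *
        Real.cos (Real.pi * X z)) (Real.sin (Real.pi * Y z) * Real.sin (Real.pi * X z)) 0,
      fun x => qv (Real.cos (Real.pi * M x)) (Real.sin (Real.pi * M x) *
        Real.cos (Real.pi * L x)) (Real.sin (Real.pi * M x) * Real.sin (Real.pi * L x)) 0,
      continuous_qv (by fun_prop) (by fun_prop) (by fun_prop) (by fun_prop),
      continuous_qv (by fun_prop) (by fun_prop) (by fun_prop) (by fun_prop),
      fun z => qv_ne_zero ?_, fun z => qv_ne_zero ?_, ?_, ?_, ?_⟩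
    · linear_combination Real.cos_sq_add_sin_sq (Real.pi * Y z) +
        Real.sin (Real.pi * Y z) ^ 2 * Real.cos_sq_add_sin_sq (Real.pi * X z)
    · linear_combination Real.cos_sq_add_sin_sq (Real.pi * M z) +
        Real.sin (Real.pi * M z) ^ 2 * Real.cos_sq_add_sin_sq (Real.pi * L z)
    · intro k θ hθ
      rcases H k θ hθ with ⟨-, h, h', h''⟩ | ⟨-, h, h', h''⟩ | ⟨-, h, h', h''⟩ <;>
        simp [h, h', h'', smul_qv, b1, b2, b3, b4, -neg_smul]
    · intro x hx
      simp only [hLe x hx, hMe x hx]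
    · intro z x h
      obtain ⟨ε, hε, h1, h2⟩ := hLX z x h
      have h3 := hSX z x h ε h1 h2
      have h4 : ∃ δ : ℝ, (δ = 1 ∨ δ = -1) ∧
          Real.cos (Real.pi * M x) = δ * Real.cos (Real.pi * (ε * Y z)) ∧
          Real.sin (Real.pi * M x) = δ * Real.sin (Real.pi * (ε * Y z)) := by
        apply half_angle
        · rw [hMc, Function.comp, ← h, hc2']
          rcases hε with rfl | rfl <;> simp
        · rw [hMs, h3]
          rcases hε with rfl | rfl <;> simp
      obtain ⟨δ, hδ, h5, h6⟩ := h4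
      simp only [h1, h2, h5, h6]
      rcases hδ with rfl | rfl
      · left
        rcases hε with rfl | rfl <;> simp
      · right
        rw [neg_qv]
        rcases hε with rfl | rfl <;> simp

lemma tent_arc {m : ℕ} {k : Fin 3} (hk : (k : ℕ) = m) {θ : ℝ} (hθ : θ ∈ arc k) :
    ∃ t : ℝ, t = 3 / Real.pi * θ ∧ 3 / Real.pi * (θ + Real.pi / 3) = t + 1 ∧
      2 * (m : ℝ) ≤ t ∧ t ≤ 2 * m + 1 := by
  have hp := Real.pi_pos
  obtain ⟨h1, h2⟩ := hθ
  have hkm : (k : ℝ) = m := by exact_mod_cast hk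
  rw [hkm] at h1 h2
  refine ⟨_, rfl, by field_simp, ?_, ?_⟩
  · rw [div_mul_eq_mul_div, le_div_iff₀ hp]; linarith
  · rw [div_mul_eq_mul_div, div_le_iff₀ hp]; linarith

/-- Every sign system is trivialized by a map from the projective plane. -/
lemma triv_all {F : ℂ → DyckSurface} (hF : Continuous F)
    (hev : ∀ x : ℂ, ‖x‖ = 1 → F (-x) = F x) {s : Fin 3 → ℝ} (hs : ∀ k, s k = 1 ∨ s k = -1) :
    Triv F s := by
  have hp := Real.pi_pos
  have main : ∀ j : ℝ, (j = 0 ∨ j = 2) →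
      ∃ X Y : Dsc → ℝ, Continuous X ∧ Continuous Y ∧
        (∀ θ ∈ Set.Icc 0 (2 * Real.pi),
          X (bp θ) = max 0 (min (3 / Real.pi * θ - j) (j + 4 - 3 / Real.pi * θ))) ∧
        (∀ θ ∈ Set.Icc 0 (2 * Real.pi),
          Y (bp θ) = max 0 (min (3 / Real.pi * θ - j - 2) (j + 4 - 3 / Real.pi * θ))) := by
    intro j hj
    have e6 : 3 / Real.pi * (2 * Real.pi) = 6 := by field_simp; norm_num
    obtain ⟨X, hX, hX'⟩ := bdry_ext
      (b := fun θ => max 0 (min (3 / Real.pi * θ - j) (j + 4 - 3 / Real.pi * θ))) (by fun_prop)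
      (by rcases hj with rfl | rfl <;> simp only [e6] <;> norm_num)
    obtain ⟨Y, hY, hY'⟩ := bdry_ext
      (b := fun θ => max 0 (min (3 / Real.pi * θ - j - 2) (j + 4 - 3 / Real.pi * θ)))
      (by fun_prop) (by rcases hj with rfl | rfl <;> simp only [e6] <;> norm_num)
    exact ⟨X, Y, hX, hY, hX', hY'⟩
  have mem : ∀ (k : Fin 3) θ, θ ∈ arc k → θ ∈ Set.Icc 0 (2 * Real.pi) ∧
      θ + Real.pi / 3 ∈ Set.Icc 0 (2 * Real.pi) := by
    intro k θ hθ
    obtain ⟨h1, h2⟩ := hθ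
    have hk0 : (0 : ℝ) ≤ (k : ℝ) := by positivity
    have hk2 : (k : ℝ) ≤ 2 := by exact_mod_cast (show (k : ℕ) ≤ 2 by omega)
    refine ⟨⟨?_, ?_⟩, ⟨?_, ?_⟩⟩ <;> nlinarith
  have k0 : Triv F ![-1, -1, 1] ∧ Triv F ![1, -1, 1] := by
    obtain ⟨X, Y, hX, hY, hX', hY'⟩ := main 0 (Or.inl rfl)
    refine klein hF hev hX hY ?_
    intro k θ hθ
    rw [hX' _ (mem k θ hθ).1, hX' _ (mem k θ hθ).2, hY' _ (mem k θ hθ).1, hY' _ (mem k θ hθ).2]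
    obtain ⟨t, ht, ht', h1, h2⟩ := tent_arc rfl hθ
    rw [ht', ← ht]
    fin_cases k
    · left
      simp at h1 h2 ⊢
      grind
    · right; left
      simp at h1 h2 ⊢
      grind
    · right; right
      simp at h1 h2 ⊢
      grind
  have k2 : Triv F ![1, -1, -1] ∧ Triv F ![1, 1, -1] := by
    obtain ⟨X, Y, hX, hY, hX', hY'⟩ := main 2 (Or.inr rfl)
    refine klein hF hev hX hY ?_
    intro k θ hθ
    rw [hX' _ (mem k θ hθ).1, hX' _ (mem k θ hθ).2, hY' _ (mem k θ hθ).1, hY' _ (mem k θ hθ).2]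
    obtain ⟨t, ht, ht', h1, h2⟩ := tent_arc rfl hθ
    rw [ht', ← ht]
    fin_cases k
    · right; right
      simp at h1 h2 ⊢
      grind
    · left
      simp at h1 h2 ⊢
      grind
    · right; left
      simp at h1 h2 ⊢
      grind
  have e0 : Triv F ![-1, 1, 1] := by
    convert k0.1.mul k0.2 using 1
    ext k; fin_cases k <;> simp
  have e00 : Triv F ![1, 1, 1] := by
    convert e0.mul e0 using 1
    ext k; fin_cases k <;> simp
  have f0 : Triv F ![s 0, 1, 1] := by
    rcases hs 0 with h | h <;> rw [h] <;> assumption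
  have f1 : Triv F ![1, s 1, 1] := by
    rcases hs 1 with h | h <;> rw [h]
    exacts [e00, k0.2]
  have f2 : Triv F ![1, 1, s 2] := by
    rcases hs 2 with h | h <;> rw [h]
    exacts [e00, k2.2]
  convert (f0.mul f1).mul f2 using 1
  ext k; fin_cases k <;> simp

/-! ### The double covering of projective space -/

/-- The Euclidean space containing the three-sphere. -/
abbrev E4 := EuclideanSpace ℝ (Fin 4)

/-- The double covering `S³ → ℝP³`. -/
def pr (x : ↥(sphere (0 : E4) 1)) : Proj E4 := Quotient.mk (projSetoid E4) x

lemma pr_eq {x y : ↥(sphere (0 : E4) 1)} : pr x = pr y ↔ (x : E4) = y ∨ (x : E4) = -(y : E4) :=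
  Quotient.eq (r := projSetoid E4)

lemma isCoveringMap_pr : IsCoveringMap pr := by
  have h : IsQuotientCoveringMap pr ↥(sphere (0 : ℝ) 1) := by
    have hg : ∀ g : ↥(sphere (0 : ℝ) 1), (g : ℝ) = 1 ∨ (g : ℝ) = -1 := by
      intro g
      have := mem_sphere_zero_iff_norm.1 g.2
      rw [Real.norm_eq_abs] at this
      exact eq_or_eq_neg_of_abs_eq this
    refine { toIsQuotientMap := isQuotientMap_quot_mk, apply_eq_iff_mem_orbit := ?_,
             continuous_const_smul := fun g => continuous_const_smul g, disjoint := ?_ }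
    · intro x y
      rw [pr_eq]
      constructor
      · rintro (hxy | hxy)
        · exact ⟨1, Subtype.ext (by simp [hxy])⟩
        · exact ⟨-1, Subtype.ext (by
            change (-1 : ℝ) • (y : E4) = x
            rw [hxy]; simp)⟩
      · rintro ⟨g, rfl⟩
        change (g : ℝ) • (y : E4) = y ∨ (g : ℝ) • (y : E4) = -y
        rcases hg g with h | h <;> simp [h]
    · intro e
      refine ⟨ball e 1, ball_mem_nhds _ one_pos, ?_⟩
      rintro g ⟨_, ⟨u, hu, rfl⟩, hu'⟩
      rcases hg g with h | h
      · exact Subtype.ext h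
      · exfalso
        have h1 : dist (u : E4) e < 1 := hu
        have h2 : dist ((g : ℝ) • (u : E4)) e < 1 := hu'
        rw [h, neg_one_smul] at h2
        have h3 : dist (u : E4) (-(u : E4)) ≤ _ := dist_triangle_right _ _ (e : E4)
        have h4 : dist (u : E4) (-(u : E4)) = 2 := by
          rw [dist_eq_norm, sub_neg_eq_add, ← two_smul ℝ, norm_smul,
            mem_sphere_zero_iff_norm.1 u.2]
          norm_num
        linarith
  exact h.isCoveringMap

/-- Radial retraction of the plane onto the disc. -/
def retr (z : ℂ) : Dsc :=
  ⟨(max 1 ‖z‖)⁻¹ • z, by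
    have h0 : 0 < max 1 ‖z‖ := lt_max_of_lt_left one_pos
    rw [mem_closedBall_zero_iff, norm_smul, norm_inv, Real.norm_of_nonneg h0.le,
      inv_mul_le_iff₀ h0]
    simp⟩

lemma continuous_retr : Continuous retr := by
  refine Continuous.subtype_mk (Continuous.smul (Continuous.inv₀
    (continuous_const.max continuous_norm) ?_) continuous_id) _
  intro z
  exact (lt_max_of_lt_left one_pos).ne'

lemma retr_coe (z : Dsc) : retr z = z := by
  apply Subtype.ext
  have h := mem_closedBall_zero_iff.1 z.2
  simp [retr, max_eq_left h]

/-- The main argument: no map from the projective plane to Dyck's surface followed by a map to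
projective three-space is nontrivial on fundamental groups. -/
lemma core {F : ℂ → DyckSurface} (hF : Continuous F) (hev : ∀ x : ℂ, ‖x‖ = 1 → F (-x) = F x)
    {e : DyckSurface → Proj E4} (he : Continuous e) {E : ℂ → ↥(sphere (0 : E4) 1)}
    (hE : Continuous E) (hlift : ∀ x, pr (E x) = e (F x))
    (hodd : ∀ x : ℂ, ‖x‖ = 1 → (E (-x) : E4) = -(E x : E4)) : False := by
  let f : C(ℂ, Proj E4) :=
    ⟨fun z => e (toDyck (retr z)), he.comp (continuous_toDyck.comp continuous_retr)⟩
  obtain ⟨e₀, he₀⟩ : ∃ e₀, pr e₀ = f 0 := Quot.mk_surjective _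
  obtain ⟨l, ⟨-, hl⟩, -⟩ := isCoveringMap_pr.existsUnique_continuousMap_lifts f 0 e₀ he₀
  let ι : E4 → Quaternion ℝ := Quaternion.linearIsometryEquivTuple.symm
  have hι : Continuous ι := Quaternion.linearIsometryEquivTuple.symm.continuous
  have hιneg : ∀ x, ι (-x) = -ι x := fun x => map_neg _ x
  have hι0 : ∀ x : ↥(sphere (0 : E4) 1), ι x ≠ 0 := by
    intro x hx
    have h1 : (x : E4) = 0 :=
      (map_eq_zero_iff _ Quaternion.linearIsometryEquivTuple.symm.injective).1 hx
    have h2 := mem_sphere_zero_iff_norm.1 x.2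
    rw [h1, norm_zero] at h2
    exact zero_ne_one h2
  let w : Dsc → Quaternion ℝ := fun z => ι (l (z : ℂ))
  have hw : Continuous w := by fun_prop
  have hw0 : ∀ z, w z ≠ 0 := fun z => hι0 _
  have hlz : ∀ z : Dsc, pr (l (z : ℂ)) = e (toDyck z) := by
    intro z
    have := congrFun hl (z : ℂ)
    simp only [Function.comp] at this
    rw [this]
    change e (toDyck (retr z)) = _
    rw [retr_coe]
  -- signs along the edges
  have hsign : ∀ k, ∃ s : ℝ, (s = 1 ∨ s = -1) ∧
      ∀ θ ∈ arc k, w (bp (θ + Real.pi / 3)) = s • w (bp θ) := by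
    intro k
    have := global_sign (S := arc k) isPreconnected_Icc
      (f := fun θ => w (bp (θ + Real.pi / 3))) (g := fun θ => w (bp θ))
      (hw.comp (continuous_bp.comp (by fun_prop))).continuousOn
      (hw.comp continuous_bp).continuousOn (fun θ _ => hw0 _) (by
        intro θ hθ
        have h1 : pr (l (bp (θ + Real.pi / 3) : ℂ)) = pr (l (bp θ : ℂ)) := by
          rw [hlz, hlz, toDyck_glue hθ]
        rcases pr_eq.1 h1 with h | h
        · left
          simp only [w, h]
        · right
          simp only [w, h, hιneg])
    rcases this with h | h
    · exact ⟨1, Or.inl rfl, fun θ hθ => by rw [one_smul]; exact h θ hθ⟩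
    · exact ⟨-1, Or.inr rfl, fun θ hθ => by rw [neg_one_smul]; exact h θ hθ⟩
  choose s hs hsw using hsign
  obtain ⟨v, V, cv, cV, nv, nV, gv, eV, hV⟩ := triv_all hF hev hs
  obtain ⟨T, hT, hTw⟩ := descend (f := fun z => w z * v z) (hw.mul cv) (by
    intro k θ hθ
    simp only [hsw k θ hθ, gv k θ hθ, smul_mul_smul_comm]
    rcases hs k with h | h <;> simp [h])
  have hcmp := global_sign (S := (univ : Set ℂ)) isPreconnected_univ
    (f := fun x => ι (E x) * V x) (g := fun x => T (F x))
    ((hι.comp (continuous_subtype_val.comp hE)).mul cV).continuousOn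
    (hT.comp hF).continuousOn
    (by
      intro x _
      obtain ⟨z, hz⟩ := toDyck_surj (F x)
      rw [← hz, hTw]
      exact mul_ne_zero (hw0 z) (nv z))
    (by
      intro x _
      obtain ⟨z, hz⟩ := toDyck_surj (F x)
      simp only [← hz, hTw]
      have h1 : pr (E x) = pr (l (z : ℂ)) := by rw [hlift, hlz, hz]
      have h2 : ι (E x) = w z ∨ ι (E x) = -w z := by
        rcases pr_eq.1 h1 with h | h
        · left
          simp only [w, h]
        · right
          simp only [w, h, hιneg]
      rcases h2 with h2 | h2 <;> rcases hV z x hz with h3 | h3 <;> simp [h2, h3])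
  have hone : ‖(1 : ℂ)‖ = 1 := by simp
  have hoddp : ι (E (-1)) * V (-1) = -(ι (E 1) * V 1) := by
    rw [hodd 1 hone, eV 1 hone, hιneg, neg_mul]
  have hne : ι (E 1) * V 1 ≠ 0 := mul_ne_zero (hι0 _) (nV _)
  have hself : ι (E 1) * V 1 = ι (E (-1)) * V (-1) := by
    rcases hcmp with h | h
    · have h1 := h 1 trivial
      have h2 := h (-1) trivial
      simp only [hev 1 hone] at h1 h2
      rw [h1, h2]
    · have h1 := h 1 trivial
      have h2 := h (-1) trivial
      simp only [hev 1 hone] at h1 h2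
      rw [h1, h2]
  rw [hoddp] at hself
  exact hne (zero_of_self_neg hself)

/-- The unnormalized hemisphere map. -/
def hemi₀ (z : ℂ) : E4 := !₂[z.re, z.im, max 0 (1 - ‖z‖), 0]

lemma continuous_hemi₀ : Continuous hemi₀ := by
  refine (PiLp.continuous_toLp 2 _).comp (continuous_pi fun i => ?_)
  fin_cases i
  · exact Complex.continuous_re
  · exact Complex.continuous_im
  · exact continuous_const.max (continuous_const.sub continuous_norm)
  · exact continuous_const

lemma hemi₀_ne (z : ℂ) : hemi₀ z ≠ 0 := by
  intro h
  have h0 : z.re = 0 := congrArg (fun v : E4 => v 0) h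
  have h1 : z.im = 0 := congrArg (fun v : E4 => v 1) h
  have h2 : max 0 (1 - ‖z‖) = 0 := congrArg (fun v : E4 => v 2) h
  have hz : z = 0 := Complex.ext h0 h1
  rw [hz] at h2
  simp at h2

/-- The hemisphere map from the plane to the three-sphere. -/
def hemi (z : ℂ) : ↥(sphere (0 : E4) 1) :=
  ⟨‖hemi₀ z‖⁻¹ • hemi₀ z, by
    rw [mem_sphere_zero_iff_norm, norm_smul, norm_inv, norm_norm,
      inv_mul_cancel₀ (norm_ne_zero_iff.2 (hemi₀_ne z))]⟩

lemma continuous_hemi : Continuous hemi :=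
  Continuous.subtype_mk ((continuous_hemi₀.norm.inv₀
    (fun z => norm_ne_zero_iff.2 (hemi₀_ne z))).smul continuous_hemi₀) _

lemma hemi_three (z : ℂ) : (hemi z : E4) 3 = 0 := by
  simp [hemi, hemi₀]

lemma hemi_neg {z : ℂ} (hz : ‖z‖ = 1) : (hemi (-z) : E4) = -(hemi z : E4) := by
  have : hemi₀ (-z) = -hemi₀ z := by
    ext i
    fin_cases i <;> simp [hemi₀, hz]
  simp [hemi, this]

/-- The standardly embedded `ℝP² ⊂ ℝP³` cannot be deformed, by a homotopy in `ℝP³`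
starting from the inclusion, into an embedded copy of Dyck's surface `ℝP² # T`. -/
theorem no_homotopy_rp2_into_dyckSurface
    (P : Set (Proj (EuclideanSpace ℝ (Fin 4))))
    (hP : P = {p | ∃ x : ↥(sphere (0 : EuclideanSpace ℝ (Fin 4)) 1),
      (x : EuclideanSpace ℝ (Fin 4)) 3 = 0 ∧
      Quotient.mk (projSetoid (EuclideanSpace ℝ (Fin 4))) x = p})
    (D : Set (Proj (EuclideanSpace ℝ (Fin 4))))
    (hD : ∃ e : DyckSurface → Proj (EuclideanSpace ℝ (Fin 4)),
      Topology.IsEmbedding e ∧ D = Set.range e) :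
    ¬ BringsTo P D := by
  subst hP
  obtain ⟨e, he, rfl⟩ := hD
  rintro ⟨H, H0, H1⟩
  -- the plane as a parametrization of the projective plane
  let φ : ℂ → ↥{p : Proj E4 | ∃ x : ↥(sphere (0 : E4) 1), (x : E4) 3 = 0 ∧
      Quotient.mk (projSetoid E4) x = p} := fun z => ⟨pr (hemi z), hemi z, hemi_three z, rfl⟩
  have hφ : Continuous φ :=
    Continuous.subtype_mk (isCoveringMap_pr.continuous.comp continuous_hemi) _
  have hφe : ∀ z : ℂ, ‖z‖ = 1 → φ (-z) = φ z := by
    intro z hz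
    exact Subtype.ext (pr_eq.2 (Or.inr (hemi_neg hz)))
  choose F hF using fun z : ℂ => H1 (φ z)
  have hFc : Continuous F := by
    rw [he.continuous_iff]
    have : e ∘ F = fun z => H (φ z, 1) := funext hF
    rw [this]
    exact H.continuous.comp (hφ.prodMk continuous_const)
  have hFe : ∀ z : ℂ, ‖z‖ = 1 → F (-z) = F z := by
    intro z hz
    apply he.injective
    rw [hF, hF, hφe z hz]
  -- lift the homotopy
  let G : C(ℂ × ℝ, Proj E4) :=
    ⟨fun q => H (φ q.1, projIcc (0 : ℝ) 1 zero_le_one q.2),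
      H.continuous.comp ((hφ.comp continuous_fst).prodMk
        (continuous_projIcc.comp continuous_snd))⟩
  have hG0 : ∀ z, G (z, 0) = pr (hemi z) := by
    intro z
    change H (φ z, projIcc (0 : ℝ) 1 zero_le_one 0) = _
    rw [projIcc_left]
    exact H0 (φ z)
  have hG1 : ∀ z, G (z, 1) = e (F z) := by
    intro z
    change H (φ z, projIcc (0 : ℝ) 1 zero_le_one 1) = _
    rw [projIcc_right]
    exact (hF z).symm
  obtain ⟨K, ⟨-, hK⟩, -⟩ := isCoveringMap_pr.existsUnique_continuousMap_lifts G (0, 0) (hemi 0)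
    (hG0 0).symm
  have hK' : ∀ q, pr (K q) = G q := fun q => congrFun hK q
  have hne : ∀ x : ↥(sphere (0 : E4) 1), (x : E4) ≠ 0 := fun x =>
    ne_zero_of_mem_unit_sphere x
  -- at time zero the lift is the hemisphere map up to a sign
  have hK0 := global_sign (S := (univ : Set ℂ)) isPreconnected_univ
    (f := fun z => (K (z, 0) : E4)) (g := fun z => (hemi z : E4))
    (by fun_prop) (continuous_subtype_val.comp continuous_hemi).continuousOn
    (fun z _ => hne _) (fun z _ => pr_eq.1 (by rw [hK', hG0]))
  have hodd0 : ∀ z : ℂ, ‖z‖ = 1 → (K (-z, 0) : E4) = -(K (z, 0) : E4) := by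
    intro z hz
    rcases hK0 with h | h
    · have h1 : (K (z, 0) : E4) = _ := h z trivial
      have h2 := h (-z) trivial
      exact h2.trans (by rw [h1, hemi_neg hz])
    · have h1 : (K (z, 0) : E4) = _ := h z trivial
      have h2 := h (-z) trivial
      exact h2.trans (by rw [h1, hemi_neg hz])
  have hodd1 : ∀ z : ℂ, ‖z‖ = 1 → (K (-z, 1) : E4) = -(K (z, 1) : E4) := by
    intro z hz
    have := global_sign (S := (univ : Set ℝ)) isPreconnected_univ
      (f := fun t => (K (-z, t) : E4)) (g := fun t => (K (z, t) : E4))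
      (by fun_prop) (by fun_prop) (fun t _ => hne _) (fun t _ => pr_eq.1 (by
        rw [hK', hK']
        change H (φ (-z), _) = H (φ z, _)
        rw [hφe z hz]))
    rcases this with h | h
    · exfalso
      have h1 : (K (-z, 0) : E4) = K (z, 0) := h 0 trivial
      rw [hodd0 z hz] at h1
      exact hne _ (zero_of_self_neg h1.symm)
    · exact h 1 trivial
  exact core hFc hFe he.continuous (E := fun z => K (z, 1)) (by fun_prop)
    (fun z => by rw [hK', hG1]) hodd1

end
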